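/- arXiv:2101.06841 — 3 statements merged into one kernel-verified Lean document; each statement's English description precedes it below -/
import Mathlib

section
/- The A-algebra homomorphism A[z,w] → A[z]/(2z − a₁z² + a₃z⁴) sending z to the class of z and w to the class of −z³ descends to an A-algebra isomorphism A[z,w]/(z³ − w + a₁zw + a₃w², 2z − a₁z² − a₃zw, 2w − a₁zw − a₃w²) ≅ A[z]/(2z − a₁z² + a₃z⁴). -/
noncomputable section
open MvPolynomial

/-- The polynomial ring `ℤ₂[a₁, a₃]`. -/
abbrev P2 : Type := MvPolynomial (Fin 2) ℤ_[2]

/-- The generator `a₁` of `ℤ₂[a₁, a₃]`. -/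
def pa1 : P2 := X 0
/-- The generator `a₃` of `ℤ₂[a₁, a₃]`. -/
def pa3 : P2 := X 1
/-- The discriminant `Δ = a₃³(a₁³ − 27a₃)`. -/
def pΔ : P2 := pa3 ^ 3 * (pa1 ^ 3 - 27 * pa3)

/-- `A = ℤ₂[a₁, a₃][Δ⁻¹]`. -/
def A : Type := Localization.Away pΔ

instance : CommRing A := inferInstanceAs (CommRing (Localization.Away pΔ))
instance : Algebra P2 A := inferInstanceAs (Algebra P2 (Localization.Away pΔ))

/-- `a₁` as an element of `A`. -/
def a1 : A := algebraMap P2 A pa1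
/-- `a₃` as an element of `A`. -/
def a3 : A := algebraMap P2 A pa3

/-- The relation `2z − a₁z² + a₃z⁴` in `A[z]`. -/
def relz : Polynomial A := 2 * Polynomial.X - Polynomial.C a1 * Polynomial.X ^ 2 + Polynomial.C a3 * Polynomial.X ^ 4

/-- The ideal `(2z − a₁z² + a₃z⁴) ⊆ A[z]`. -/
def J : Ideal (Polynomial A) := Ideal.span {relz}

/-- `R₀ = A[z]/(2z − a₁z² + a₃z⁴)`. -/
def R0 : Type := Polynomial A ⧸ J

instance : CommRing R0 := inferInstanceAs (CommRing (Polynomial A ⧸ J))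
instance : Algebra A R0 := inferInstanceAs (Algebra A (Polynomial A ⧸ J))

/-- The quotient map `A[z] → R₀`. -/
def mkR0 : Polynomial A →+* R0 := Ideal.Quotient.mk J

/-- The class of `z` in `R₀`. -/
def z0 : R0 := mkR0 Polynomial.X

/-- The ideal `(z³ − w + a₁zw + a₃w², 2z − a₁z² − a₃zw, 2w − a₁zw − a₃w²) ⊆ A[z,w]`. -/
def Izw : Ideal (MvPolynomial (Fin 2) A) := Ideal.span
  {X 0 ^ 3 - X 1 + C a1 * X 0 * X 1 + C a3 * X 1 ^ 2,
   2 * X 0 - C a1 * X 0 ^ 2 - C a3 * X 0 * X 1,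
   2 * X 1 - C a1 * X 0 * X 1 - C a3 * X 1 ^ 2}

/-- `A[z,w]/(z³ − w + a₁zw + a₃w², 2z − a₁z² − a₃zw, 2w − a₁zw − a₃w²)`. -/
def Dzw : Type := MvPolynomial (Fin 2) A ⧸ Izw

instance : CommRing Dzw := inferInstanceAs (CommRing (MvPolynomial (Fin 2) A ⧸ Izw))
instance : Algebra A Dzw := inferInstanceAs (Algebra A (MvPolynomial (Fin 2) A ⧸ Izw))

/-- The quotient map `A[z,w] → Dzw`. -/
def mkD : MvPolynomial (Fin 2) A →+* Dzw := Ideal.Quotient.mk Izw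

lemma algebraMap_R0_eq (a : A) : algebraMap A R0 a = mkR0 (Polynomial.C a) := rfl

lemma algebraMap_Dzw_eq (a : A) : algebraMap A Dzw a = mkD (C a) := rfl

lemma z0_relation :
    2 * z0 - algebraMap A R0 a1 * z0 ^ 2 + algebraMap A R0 a3 * z0 ^ 4 = 0 := by
  have h : mkR0 relz = 0 := Ideal.Quotient.eq_zero_iff_mem.2 (Ideal.subset_span rfl)
  simpa only [relz, map_add, map_sub, map_mul, map_pow, map_ofNat, algebraMap_R0_eq, z0] using h

lemma mkD_eq_zero {p : MvPolynomial (Fin 2) A} (hp : p ∈ Izw) : mkD p = 0 :=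
  Ideal.Quotient.eq_zero_iff_mem.2 hp

/-- The sum of the first and the third relation of `Dzw` is `w + z³`. -/
lemma mkD_X_one : mkD (X 1) = -mkD (X 0) ^ 3 := by
  have h₁ := mkD_eq_zero (Ideal.subset_span (Or.inl rfl))
  have h₃ := mkD_eq_zero (Ideal.subset_span (Or.inr (Or.inr rfl)))
  simp only [map_add, map_sub, map_mul, map_pow, map_ofNat] at h₁ h₃
  linear_combination h₁ + h₃

lemma mkD_X_zero_relation :
    2 * mkD (X 0) - algebraMap A Dzw a1 * mkD (X 0) ^ 2
      + algebraMap A Dzw a3 * mkD (X 0) ^ 4 = 0 := by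
  have h₂ := mkD_eq_zero (Ideal.subset_span (Or.inr (Or.inl rfl)))
  simp only [map_sub, map_mul, map_pow, map_ofNat, mkD_X_one] at h₂
  rw [algebraMap_Dzw_eq, algebraMap_Dzw_eq]
  linear_combination h₂

/-- The homomorphism `Dzw → R₀` with `z ↦ z` and `w ↦ -z³`. -/
def toR0 : Dzw →ₐ[A] R0 :=
  Ideal.Quotient.liftₐ Izw (aeval ![z0, -z0 ^ 3]) fun p hp ↦ by
    suffices h : Izw ≤ RingHom.ker (aeval (R := A) ![z0, -z0 ^ 3]) from h hp
    refine Ideal.span_le.2 ?_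
    rintro _ (rfl | rfl | rfl) <;>
      simp only [SetLike.mem_coe, RingHom.mem_ker, map_add, map_sub, map_mul, map_pow, map_ofNat,
        aeval_X, aeval_C, Matrix.cons_val_zero, Matrix.cons_val_one]
    · linear_combination z0 ^ 2 * z0_relation
    · linear_combination z0_relation
    · linear_combination -z0 ^ 2 * z0_relation

/-- The homomorphism `R₀ → Dzw` with `z ↦ z`. -/
def ofR0 : R0 →ₐ[A] Dzw :=
  Ideal.Quotient.liftₐ J (Polynomial.aeval (mkD (X 0))) fun p hp ↦ by
    suffices h : J ≤ RingHom.ker (Polynomial.aeval (R := A) (mkD (X 0))) from h hp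
    refine Ideal.span_le.2 ?_
    rintro _ rfl
    simpa only [SetLike.mem_coe, RingHom.mem_ker, relz, map_add, map_sub, map_mul, map_pow,
      map_ofNat, Polynomial.aeval_X, Polynomial.aeval_C] using mkD_X_zero_relation

lemma toR0_mkD (p : MvPolynomial (Fin 2) A) : toR0 (mkD p) = aeval ![z0, -z0 ^ 3] p := rfl

lemma ofR0_mkR0 (p : Polynomial A) : ofR0 (mkR0 p) = Polynomial.aeval (mkD (X 0)) p := rfl

lemma toR0_mkD_X_zero : toR0 (mkD (X 0)) = z0 := by simp [toR0_mkD]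

lemma toR0_mkD_X_one : toR0 (mkD (X 1)) = -z0 ^ 3 := by simp [toR0_mkD]

lemma ofR0_z0 : ofR0 z0 = mkD (X 0) := by simp [z0, ofR0_mkR0]

lemma toR0_comp_ofR0 : toR0.comp ofR0 = AlgHom.id A R0 := by
  refine Ideal.Quotient.algHom_ext (I := J) A (Polynomial.algHom_ext ?_)
  change toR0 (ofR0 z0) = z0
  rw [ofR0_z0, toR0_mkD_X_zero]

lemma ofR0_comp_toR0 : ofR0.comp toR0 = AlgHom.id A Dzw := by
  refine Ideal.Quotient.algHom_ext (I := Izw) A (MvPolynomial.algHom_ext fun i ↦ ?_)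
  change ofR0 (toR0 (mkD (X i))) = mkD (X i)
  fin_cases i
  · simp [toR0_mkD_X_zero, ofR0_z0]
  · change ofR0 (toR0 (mkD (X 1))) = mkD (X 1)
    rw [toR0_mkD_X_one, map_neg, map_pow, ofR0_z0, mkD_X_one]

/-- the `A`-algebra homomorphism `A[z,w] → A[z]/(2z − a₁z² + a₃z⁴)`, `z ↦ z`,
`w ↦ −z³`, descends to an `A`-algebra isomorphism
`A[z,w]/(z³ − w + a₁zw + a₃w², 2z − a₁z² − a₃zw, 2w − a₁zw − a₃w²) ≅ A[z]/(2z − a₁z² + a₃z⁴)`. -/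
theorem stmt5 :
    ∃ e : Dzw ≃ₐ[A] R0, e (mkD (X 0)) = z0 ∧ e (mkD (X 1)) = -z0 ^ 3 :=
  ⟨AlgEquiv.ofAlgHom toR0 ofR0 toR0_comp_ofR0 ofR0_comp_toR0,
    toR0_mkD_X_zero, toR0_mkD_X_one⟩
end
end

section
/- In the quotient ring R₀ := A[z]/(2z − a₁z² + a₃z⁴): (i) the annihilator of the class of z equals the principal ideal generated by the class of 2 − a₁z + a₃z³; and (ii) the class of 2 − a₁z + a₃z³ is the unique element x ∈ R₀ such that z·x = 0 and x − 2 lies in the ideal generated by the class of z. (This identifies the image of 1 under the transfer map TMF₁(3) → TMF₁(3)^{BC₂}.) -/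
noncomputable section
open MvPolynomial

/-- The transfer element `2 − a₁z + a₃z³` in `R₀`. -/
def trR0 : R0 := mkR0 (2 - Polynomial.C a1 * Polynomial.X + Polynomial.C a3 * Polynomial.X ^ 3)

/-- The polynomial `2 − a₁z + a₃z³`, whose class in `R₀` is `trR0`. -/
def trPoly : Polynomial A :=
  2 - Polynomial.C a1 * Polynomial.X + Polynomial.C a3 * Polynomial.X ^ 3

lemma relz_eq_X_mul_trPoly : relz = Polynomial.X * trPoly := by
  unfold relz trPoly
  ring

lemma mkR0_surjective : Function.Surjective mkR0 := Ideal.Quotient.mk_surjective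

lemma mkR0_eq_zero_iff (p : Polynomial A) : mkR0 p = 0 ↔ relz ∣ p :=
  Ideal.Quotient.eq_zero_iff_mem.trans Ideal.mem_span_singleton

lemma z0_mul_trR0 : z0 * trR0 = 0 := by
  have h : mkR0 (Polynomial.X * trPoly) = 0 :=
    (mkR0_eq_zero_iff _).2 relz_eq_X_mul_trPoly.dvd
  rwa [map_mul] at h

lemma z0_mul_eq_zero_iff (x : R0) : z0 * x = 0 ↔ trR0 ∣ x := by
  constructor
  · obtain ⟨p, rfl⟩ := mkR0_surjective x
    intro h
    rw [z0, ← map_mul, mkR0_eq_zero_iff, relz_eq_X_mul_trPoly] at h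
    obtain ⟨q, hq⟩ := h
    rw [mul_assoc] at hq
    rw [Polynomial.isRegular_X.left hq]
    exact map_dvd mkR0 (dvd_mul_right trPoly q)
  · rintro ⟨y, rfl⟩
    rw [← mul_assoc, z0_mul_trR0, zero_mul]

lemma two_mem_nonZeroDivisors_A : (2 : A) ∈ nonZeroDivisors A := by
  have h : (2 : P2) ∈ nonZeroDivisors P2 := mem_nonZeroDivisors_of_ne_zero two_ne_zero
  have h' := IsLocalization.map_nonZeroDivisors_le (Submonoid.powers pΔ)
    (Localization.Away pΔ) (Submonoid.mem_map_of_mem _ h)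
  have h2 : algebraMap P2 (Localization.Away pΔ) 2 = 2 := map_ofNat _ 2
  exact h2 ▸ h'

lemma coeff_zero_eq_zero_of_mkR0_mem_span_z0 {p : Polynomial A}
    (h : mkR0 p ∈ Ideal.span {z0}) : p.coeff 0 = 0 := by
  obtain ⟨y, hy⟩ := Ideal.mem_span_singleton.1 h
  obtain ⟨q, rfl⟩ := mkR0_surjective y
  rw [z0, ← map_mul, ← sub_eq_zero, ← map_sub, mkR0_eq_zero_iff] at hy
  have hX : Polynomial.X ∣ p - Polynomial.X * q :=
    (Dvd.intro _ relz_eq_X_mul_trPoly.symm).trans hy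
  exact Polynomial.X_dvd_iff.1 ((dvd_sub_left (dvd_mul_right _ q)).1 hX)

lemma trR0_sub_two_mem_span_z0 : trR0 - 2 ∈ Ideal.span {z0} := by
  refine Ideal.mem_span_singleton.2
    ⟨mkR0 (-Polynomial.C a1 + Polynomial.C a3 * Polynomial.X ^ 2), ?_⟩
  rw [z0, trR0, ← map_mul, ← map_ofNat mkR0 2, ← map_sub]
  congr 1
  ring

lemma eq_trR0_of_trR0_dvd {x : R0} (h : trR0 ∣ x) (hx : x - 2 ∈ Ideal.span {z0}) :
    x = trR0 := by
  obtain ⟨y, rfl⟩ := h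
  obtain ⟨q, rfl⟩ := mkR0_surjective y
  have hc : (trPoly * q - 2).coeff 0 = 0 := by
    apply coeff_zero_eq_zero_of_mkR0_mem_span_z0
    rwa [map_sub, map_mul, map_ofNat]
  have hq : q.coeff 0 - 1 = 0 := by
    apply (mul_left_mem_nonZeroDivisors_eq_zero_iff two_mem_nonZeroDivisors_A).1
    simp [trPoly] at hc
    linear_combination hc
  obtain ⟨r, hr⟩ : Polynomial.X ∣ q - 1 := Polynomial.X_dvd_iff.2 (by simpa using hq)
  rw [sub_eq_iff_eq_add.1 hr, map_add, map_mul, map_one]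
  change trR0 * (z0 * mkR0 r + 1) = trR0
  linear_combination mkR0 r * z0_mul_trR0

/-- in `R₀ = A[z]/(2z − a₁z² + a₃z⁴)`:
(i) the annihilator of the class of `z` is the principal ideal generated by `2 − a₁z + a₃z³`;
(ii) `2 − a₁z + a₃z³` is the unique `x` with `z·x = 0` and `x − 2 ∈ (z)`. -/
theorem stmt7 :
    (∀ x : R0, z0 * x = 0 ↔ x ∈ Ideal.span {trR0}) ∧
    (∀ x : R0, (z0 * x = 0 ∧ x - 2 ∈ Ideal.span {z0}) ↔ x = trR0) := by
  refine ⟨fun x => (z0_mul_eq_zero_iff x).trans Ideal.mem_span_singleton.symm, fun x => ?_⟩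
  constructor
  · rintro ⟨hz, hx⟩
    exact eq_trR0_of_trR0_dvd ((z0_mul_eq_zero_iff x).1 hz) hx
  · rintro rfl
    exact ⟨z0_mul_trR0, trR0_sub_two_mem_span_z0⟩
end
end

section
/- Let R be a commutative ring and x ∈ R an element such that the intersection of the ideals (xⁿ) over all n ≥ 0 is zero. If M is a square matrix with entries in R satisfying M = x·M² (where M² is the matrix product), then M = 0. -/
theorem Matrix.eq_pow_smul_pow_succ {R ι : Type*} [CommRing R] [Fintype ι] [DecidableEq ι]
    {x : R} {M : Matrix ι ι R} (hM : M = x • (M * M)) (k : ℕ) :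
    M = x ^ k • M ^ (k + 1) := by
  induction k with
  | zero => simp
  | succ k ih =>
    calc M = x • (M * M) := hM
      _ = x • ((x ^ k • M ^ (k + 1)) * M) := by rw [← ih]
      _ = x ^ (k + 1) • M ^ (k + 1 + 1) := by
        rw [smul_mul_assoc, smul_smul, ← pow_succ', ← pow_succ]

/-- if `x` is an element of a commutative ring `R` with `⋂ₙ (xⁿ) = 0`, then any
square matrix `M` over `R` with `M = x·M²` is zero. -/
theorem stmt8 (R : Type*) [CommRing R] (x : R)
    (hx : (⨅ n : ℕ, Ideal.span {x ^ n}) = ⊥)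
    (n : ℕ) (M : Matrix (Fin n) (Fin n) R) (hM : M = x • (M * M)) :
    M = 0 := by
  ext i j
  rw [Matrix.zero_apply, ← Ideal.mem_bot, ← hx, Ideal.mem_iInf]
  intro k
  rw [Ideal.mem_span_singleton]
  exact ⟨(M ^ (k + 1)) i j, congrFun (congrFun (Matrix.eq_pow_smul_pow_succ hM k) i) j⟩
end
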